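/- arXiv:2504.12857 — 2 statements merged into one kernel-verified Lean document; each statement's English description precedes it below -/
import Mathlib

section
/- If a graph G contains three cutvertices lying in the same connected component, then G contains an induced P5 or an induced co-Gem; in particular, G or its complement fails to be distance-hereditary. -/
open SimpleGraph

/-- The path graph on 5 vertices. -/
def P5 : SimpleGraph (Fin 5) := fromEdgeSet {s(0,1), s(1,2), s(2,3), s(3,4)}

/-- The co-Gem: disjoint union of P4 (on 0,1,2,3) and K1 (vertex 4). -/
def CoGem : SimpleGraph (Fin 5) := fromEdgeSet {s(0,1), s(1,2), s(2,3)}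

/-- `G` contains an induced copy of `H`. -/
def HasInducedCopy {α β : Type*} (H : SimpleGraph α) (G : SimpleGraph β) : Prop :=
  Nonempty (H ↪g G)

/-- A graph is distance-hereditary if every connected induced subgraph preserves distances. -/
def DistanceHereditary {V : Type*} (G : SimpleGraph V) : Prop :=
  ∀ s : Set V, (G.induce s).Connected → ∀ u v : s, (G.induce s).dist u v = G.dist u v

/-- `v` is a cutvertex: deleting it increases the number of connected components. -/
def IsCutvertex {V : Type*} (G : SimpleGraph V) (v : V) : Prop :=
  Nat.card G.ConnectedComponent < Nat.card (G.induce {v}ᶜ).ConnectedComponent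

/-- An adjacency-preserving and -reflecting map out of a graph without twins is an embedding. -/
theorem hasInducedCopy_of_adj_iff {α β : Type*} {H : SimpleGraph α} {G : SimpleGraph β}
    (f : α → β) (hf : ∀ i j, G.Adj (f i) (f j) ↔ H.Adj i j)
    (htwin : ∀ i j, (∀ k, H.Adj i k ↔ H.Adj j k) → i = j) : HasInducedCopy H G := by
  refine ⟨⟨⟨f, fun i j hij => htwin i j fun k => ?_⟩, fun {i j} => hf i j⟩⟩
  rw [← hf, ← hf, hij]

theorem P5_adj_iff (i j : Fin 5) : P5.Adj i j ↔ i.val + 1 = j.val ∨ j.val + 1 = i.val := by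
  fin_cases i <;> fin_cases j <;> simp [P5]

theorem CoGem_adj_iff (i j : Fin 5) :
    CoGem.Adj i j ↔ (i.val + 1 = j.val ∧ j.val < 4) ∨ (j.val + 1 = i.val ∧ i.val < 4) := by
  fin_cases i <;> fin_cases j <;> simp [CoGem]

theorem hasInducedCopy_P5 {V : Type*} {G : SimpleGraph V} {a b c d e : V}
    (hab : G.Adj a b) (hbc : G.Adj b c) (hcd : G.Adj c d) (hde : G.Adj d e)
    (hac : ¬ G.Adj a c) (had : ¬ G.Adj a d) (hae : ¬ G.Adj a e)
    (hbd : ¬ G.Adj b d) (hbe : ¬ G.Adj b e) (hce : ¬ G.Adj c e) : HasInducedCopy P5 G := by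
  refine hasInducedCopy_of_adj_iff ![a, b, c, d, e] (fun i j => ?_) ?_
  · rw [P5_adj_iff]
    fin_cases i <;> fin_cases j <;> simp_all [G.adj_comm]
  · simp only [P5_adj_iff]
    decide

theorem hasInducedCopy_CoGem {V : Type*} {G : SimpleGraph V} {a b c d e : V}
    (hab : G.Adj a b) (hbc : G.Adj b c) (hcd : G.Adj c d)
    (hac : ¬ G.Adj a c) (had : ¬ G.Adj a d) (hbd : ¬ G.Adj b d)
    (hae : ¬ G.Adj a e) (hbe : ¬ G.Adj b e) (hce : ¬ G.Adj c e) (hde : ¬ G.Adj d e) :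
    HasInducedCopy CoGem G := by
  refine hasInducedCopy_of_adj_iff ![a, b, c, d, e] (fun i j => ?_) ?_
  · rw [CoGem_adj_iff]
    fin_cases i <;> fin_cases j <;> simp_all [G.adj_comm]
  · simp only [CoGem_adj_iff]
    decide

/-- An induced path on four vertices whose ends have a common neighbour obstructs
distance-heredity. -/
theorem not_distanceHereditary_of_path {V : Type*} {H : SimpleGraph V} {a b c d w : V}
    (hab : H.Adj a b) (hbc : H.Adj b c) (hcd : H.Adj c d)
    (hac : ¬ H.Adj a c) (had : ¬ H.Adj a d) (hbd : ¬ H.Adj b d)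
    (haw : H.Adj a w) (hwd : H.Adj w d) : ¬ DistanceHereditary H := by
  intro hH
  let s : Set V := {a, b, c, d}
  let a' : s := ⟨a, by simp [s]⟩
  let b' : s := ⟨b, by simp [s]⟩
  let c' : s := ⟨c, by simp [s]⟩
  let d' : s := ⟨d, by simp [s]⟩
  have rb : (H.induce s).Reachable a' b' := Adj.reachable (by simpa [a', b'] using hab)
  have rc : (H.induce s).Reachable a' c' :=
    rb.trans (Adj.reachable (by simpa [b', c'] using hbc))
  have rd : (H.induce s).Reachable a' d' :=
    rc.trans (Adj.reachable (by simpa [c', d'] using hcd))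
  have hconn : (H.induce s).Connected := by
    have : ∀ x : s, (H.induce s).Reachable a' x := by
      rintro ⟨x, rfl | rfl | rfl | rfl⟩
      exacts [Reachable.refl _, rb, rc, rd]
    exact (connected_iff_exists_forall_reachable _).2 ⟨a', this⟩
  have hle : (H.induce s).dist a' d' ≤ 2 := by
    rw [hH s hconn a' d']
    exact dist_le (Walk.cons haw (Walk.cons hwd Walk.nil))
  obtain ⟨p, hp⟩ := rd.exists_walk_length_eq_dist
  rw [← hp] at hle
  have hne : a' ≠ d' := fun h => hac (by
    rw [show a = d from congrArg Subtype.val h]; exact hcd.symm)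
  have hadj : ¬ (H.induce s).Adj a' d' := had
  have hmid : ∀ m, (H.induce s).Adj a' m → ¬ (H.induce s).Adj m d' := by
    rintro ⟨m, rfl | rfl | rfl | rfl⟩ h h'
    exacts [H.irrefl h, hbd h', hac h, had h]
  clear_value a' d'
  match p, hle with
  | .nil, _ => exact hne rfl
  | .cons h .nil, _ => exact hadj h
  | .cons h (.cons h' .nil), _ => exact hmid _ h h'

theorem not_distanceHereditary_compl {V : Type*} {G : SimpleGraph V} {a b c d e : V}
    (hab : G.Adj a b) (hbc : G.Adj b c) (hcd : G.Adj c d)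
    (hac : ¬ G.Adj a c) (had : ¬ G.Adj a d) (hbd : ¬ G.Adj b d)
    (hbe : ¬ G.Adj b e) (hce : ¬ G.Adj c e) (hb : b ≠ e) (hc : c ≠ e) :
    ¬ DistanceHereditary Gᶜ := by
  refine not_distanceHereditary_of_path (a := b) (b := d) (c := a) (d := c) (w := e)
    ?_ ?_ ?_ ?_ ?_ ?_ ?_ ?_ <;> rw [compl_adj]
  · exact ⟨fun h => had (h ▸ hab), hbd⟩
  · exact ⟨fun h => hac (h ▸ hcd.symm), fun h => had h.symm⟩
  · exact ⟨fun h => had (h ▸ hcd), hac⟩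
  · exact fun h => h.2 hab.symm
  · exact fun h => h.2 hbc
  · exact fun h => h.2 hcd.symm
  · exact ⟨hb, hbe⟩
  · exact ⟨hc.symm, fun h => hce h.symm⟩

theorem not_distanceHereditary_compl_of_hasInducedCopy {V : Type*} {G : SimpleGraph V}
    (h : HasInducedCopy P5 G ∨ HasInducedCopy CoGem G) : ¬ DistanceHereditary Gᶜ := by
  rcases h with ⟨⟨f⟩⟩ | ⟨⟨f⟩⟩ <;>
    refine not_distanceHereditary_compl (a := f 0) (b := f 1) (c := f 2) (d := f 3) (e := f 4)
      ?_ ?_ ?_ ?_ ?_ ?_ ?_ ?_ ?_ ?_ <;>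
    simp [f.map_adj_iff, P5_adj_iff, CoGem_adj_iff]

/-- For a cutvertex `v` and a vertex `x ≠ v`, some neighbour `u` of `v` is separated from `x`
by `v`; the set `A` collects the vertices separated from `x`. -/
theorem IsCutvertex.exists_separated {V : Type*} [Finite V] {G : SimpleGraph V} {v x : V}
    (hv : IsCutvertex G v) (hx : x ≠ v) :
    ∃ (u : V) (A : Set V), G.Adj v u ∧ u ∈ A ∧ v ∉ A ∧ x ∉ A ∧
      ∀ a ∈ A, ∀ b, G.Adj a b → b ∈ A ∨ b = v := by
  let x' : ({v}ᶜ : Set V) := ⟨x, hx⟩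
  by_cases hu : ∃ u, ∃ h : G.Adj v u,
      ¬ (G.induce {v}ᶜ).Reachable ⟨u, h.ne'⟩ x'
  · obtain ⟨u, h, hu⟩ := hu
    refine ⟨u, {w | ∃ h : w ≠ v, ¬ (G.induce {v}ᶜ).Reachable ⟨w, h⟩ x'}, h, ⟨h.ne', hu⟩,
      fun h => h.1 rfl, fun h => h.2 (Reachable.refl _), ?_⟩
    rintro a ⟨hav, har⟩ b hab
    refine or_iff_not_imp_right.2 fun hb => ⟨hb, fun hbr => har ?_⟩
    refine Reachable.trans (Adj.reachable ?_) hbr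
    simpa using hab
  · push Not at hu
    exfalso
    have key : ∀ (a b : V) (p : G.Walk a b) (hb : b ≠ v),
        (∀ ha : a ≠ v, (G.induce {v}ᶜ).Reachable ⟨a, ha⟩ ⟨b, hb⟩) ∧
        (a = v → (G.induce {v}ᶜ).Reachable x' ⟨b, hb⟩) := by
      intro a b p hb
      induction p with
      | nil => exact ⟨fun _ => Reachable.refl _, fun h => absurd h hb⟩
      | @cons a c b h p ih =>
        obtain ⟨ih₁, ih₂⟩ := ih hb
        refine ⟨fun ha => ?_, ?_⟩
        · by_cases hc : c = v
          · subst hc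
            exact (hu a h.symm).trans (ih₂ rfl)
          · refine Reachable.trans (Adj.reachable ?_) (ih₁ hc)
            simpa using h
        · rintro rfl
          exact (hu c h).symm.trans (ih₁ h.ne')
    refine absurd hv (not_lt.2 ?_)
    refine Nat.card_le_card_of_injective
      (ConnectedComponent.map (Embedding.induce ({v}ᶜ : Set V)).toHom) ?_
    intro C D
    refine ConnectedComponent.ind₂ (fun a b h => ?_) C D
    rw [ConnectedComponent.map_mk, ConnectedComponent.map_mk, ConnectedComponent.eq] at h
    obtain ⟨p⟩ := h
    exact ConnectedComponent.eq.2 ((key _ _ p b.2).1 a.2)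

/-- Two nonadjacent cutvertices in the same component force an induced `P5`. -/
theorem hasInducedCopy_P5_of_isCutvertex {V : Type*} [Finite V] {G : SimpleGraph V} {v w : V}
    (hv : IsCutvertex G v) (hw : IsCutvertex G w) (hne : v ≠ w) (hr : G.Reachable v w)
    (hadj : ¬ G.Adj v w) : HasInducedCopy P5 G := by
  obtain ⟨u, A, hvu, huA, hvA, hwA, hA⟩ := hv.exists_separated hne.symm
  obtain ⟨t, B, hwt, htB, hwB, hvB, hB⟩ := hw.exists_separated hne
  obtain ⟨p, hp⟩ := hr.exists_walk_length_eq_dist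
  have hpath := p.isPath_of_length_eq_dist hp
  have hstep : ∀ i < p.length, G.Adj (p.getVert i) (p.getVert (i + 1)) :=
    fun i hi => p.adj_getVert_succ hi
  have hfar : ∀ i j, i + 2 ≤ j → j ≤ p.length → ¬ G.Adj (p.getVert i) (p.getVert j) := by
    intro i j hij hj h
    have h1 := dist_le ((p.take i).append (Walk.cons h (p.drop j)))
    simp only [Walk.length_append, Walk.length_cons, Walk.take_length, Walk.drop_length] at h1
    omega
  have hpA : ∀ k ≤ p.length, p.getVert (p.length - k) ∉ A := by
    intro k
    induction k with
    | zero => simpa using hwA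
    | succ k ih =>
      intro hk hmem
      have h := hstep (p.length - (k + 1)) (by omega)
      rw [show p.length - (k + 1) + 1 = p.length - k by omega] at h
      rcases hA _ hmem _ h with h' | h'
      · exact ih (by omega) h'
      · have : p.length - k = 0 := hpath.getVert_injOn (by simp) (by simp) (by simpa using h')
        omega
  have huN : ∀ i, 1 ≤ i → i ≤ p.length → ¬ G.Adj u (p.getVert i) := by
    intro i h1 hi h
    rcases hA u huA _ h with h' | h'
    · exact hpA (p.length - i) (by omega) (by rwa [Nat.sub_sub_self hi])
    · have : i = 0 := hpath.getVert_injOn (by simpa using hi) (by simp) (by simpa using h')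
      omega
  have h0 : p.getVert 0 = v := p.getVert_zero
  have hlast : p.getVert p.length = w := p.getVert_length
  have hlen : 2 ≤ p.length := by
    by_contra! hlt
    interval_cases hl : p.length
    · exact hne (h0.symm.trans hlast)
    · have := hstep 0 (by omega)
      rw [h0, zero_add, hlast] at this
      exact hadj this
  have hu0 : G.Adj u (p.getVert 0) := by rw [h0]; exact hvu.symm
  rcases hlen.eq_or_lt with h2 | h3
  · rw [← h2] at hlast
    have h12 := hstep 1 (by omega)
    have h01 := hstep 0 (by omega)
    refine hasInducedCopy_P5 hu0 h01 h12 (e := t) (by rw [hlast]; exact hwt)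
      (huN 1 le_rfl (by omega)) (huN 2 (by omega) (by omega)) ?_
      (hfar 0 2 (by omega) (by omega)) ?_ ?_
    · intro h
      rcases hA u huA t h with h' | rfl
      · rcases hA t h' w hwt.symm with h'' | h''
        exacts [hwA h'', hne h''.symm]
      · exact hvB htB
    · intro h
      rw [h0] at h
      rcases hB t htB v h.symm with h' | h'
      exacts [hvB h', hne h']
    · intro h
      rcases hB t htB _ h.symm with h' | h'
      · rcases hB _ h' _ h01.symm with h'' | h''
        · exact hvB (h0 ▸ h'')
        · exact hne (h0 ▸ h'')
      · rw [hlast, ← zero_add 1] at h12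
        exact G.irrefl (h' ▸ h12)
  · exact hasInducedCopy_P5 hu0 (hstep 0 (by omega)) (hstep 1 (by omega)) (hstep 2 (by omega))
      (huN 1 le_rfl (by omega)) (huN 2 (by omega) (by omega)) (huN 3 (by omega) (by omega))
      (hfar 0 2 (by omega) (by omega)) (hfar 0 3 (by omega) (by omega))
      (hfar 1 3 (by omega) (by omega))

/-- Three pairwise adjacent cutvertices force an induced co-Gem. -/
theorem hasInducedCopy_CoGem_of_isCutvertex {V : Type*} [Finite V] {G : SimpleGraph V}
    {v₁ v₂ v₃ : V} (hc1 : IsCutvertex G v₁) (hc2 : IsCutvertex G v₂) (hc3 : IsCutvertex G v₃)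
    (h12 : G.Adj v₁ v₂) (h13 : G.Adj v₁ v₃) (h23 : G.Adj v₂ v₃) : HasInducedCopy CoGem G := by
  have pendant : ∀ {x y z : V}, IsCutvertex G x → G.Adj x y → G.Adj x z → G.Adj y z →
      ∃ (u : V) (A : Set V), G.Adj x u ∧ u ∈ A ∧ y ∉ A ∧ z ∉ A ∧
        ∀ a ∈ A, ∀ b, G.Adj a b → b ∈ A ∨ b = x := by
    intro x y z hx hxy hxz hyz
    obtain ⟨u, A, hu, huA, -, hyA, hA⟩ := hx.exists_separated hxy.ne'
    refine ⟨u, A, hu, huA, hyA, fun hz => ?_, hA⟩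
    rcases hA z hz y hyz.symm with h | h
    exacts [hyA h, hxy.ne' h]
  obtain ⟨u₁, A₁, hu₁, huA₁, h12A, h13A, hA₁⟩ := pendant hc1 h12 h13 h23
  obtain ⟨u₂, A₂, hu₂, huA₂, h21A, h23A, hA₂⟩ := pendant hc2 h12.symm h23 h13
  obtain ⟨u₃, A₃, hu₃, huA₃, h31A, h32A, hA₃⟩ := pendant hc3 h13.symm h23.symm h12
  have hn12 := h12.ne
  have hn13 := h13.ne
  have hn23 := h23.ne
  have far : ∀ {x y u w : V} {A B : Set V}, x ≠ y → u ∈ A → w ∈ B → G.Adj y w → y ∉ A → x ∉ B →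
      (∀ a ∈ A, ∀ b, G.Adj a b → b ∈ A ∨ b = x) → ¬ G.Adj u w := by
    intro x y u w A B hxy hu hw hyw hyA hxB hA h
    rcases hA u hu w h with h' | rfl
    · rcases hA w h' y hyw.symm with h'' | h''
      exacts [hyA h'', hxy h''.symm]
    · exact hxB hw
  have near : ∀ {x y u : V} {A : Set V}, x ≠ y → u ∈ A → y ∉ A →
      (∀ a ∈ A, ∀ b, G.Adj a b → b ∈ A ∨ b = x) → ¬ G.Adj u y := by
    intro x y u A hxy hu hyA hA h
    rcases hA u hu y h with h' | h'
    exacts [hyA h', hxy h'.symm]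
  exact hasInducedCopy_CoGem hu₁.symm h12 hu₂ (near hn12 huA₁ h12A hA₁)
    (far hn12 huA₁ huA₂ hu₂ h12A h21A hA₁)
    (fun h => near hn12.symm huA₂ h21A hA₂ h.symm)
    (far hn13 huA₁ huA₃ hu₃ h13A h31A hA₁)
    (fun h => near hn13.symm huA₃ h31A hA₃ h.symm)
    (fun h => near hn23.symm huA₃ h32A hA₃ h.symm)
    (far hn23 huA₂ huA₃ hu₃ h23A h32A hA₂)

/-- three cutvertices in a common component force an induced P5 or co-Gem;
in particular `G` or its complement is not distance-hereditary. -/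
theorem stmt13 {V : Type*} [Fintype V] (G : SimpleGraph V) (v₁ v₂ v₃ : V)
    (h12 : v₁ ≠ v₂) (h13 : v₁ ≠ v₃) (h23 : v₂ ≠ v₃)
    (hc1 : IsCutvertex G v₁) (hc2 : IsCutvertex G v₂) (hc3 : IsCutvertex G v₃)
    (hr12 : G.Reachable v₁ v₂) (hr13 : G.Reachable v₁ v₃) :
    (HasInducedCopy P5 G ∨ HasInducedCopy CoGem G) ∧
    (¬ DistanceHereditary G ∨ ¬ DistanceHereditary Gᶜ) := by
  have h : HasInducedCopy P5 G ∨ HasInducedCopy CoGem G := by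
    by_cases a12 : G.Adj v₁ v₂
    · by_cases a13 : G.Adj v₁ v₃
      · by_cases a23 : G.Adj v₂ v₃
        · exact .inr (hasInducedCopy_CoGem_of_isCutvertex hc1 hc2 hc3 a12 a13 a23)
        · exact .inl (hasInducedCopy_P5_of_isCutvertex hc2 hc3 h23 (hr12.symm.trans hr13) a23)
      · exact .inl (hasInducedCopy_P5_of_isCutvertex hc1 hc3 h13 hr13 a13)
    · exact .inl (hasInducedCopy_P5_of_isCutvertex hc1 hc2 h12 hr12 a12)
  exact ⟨h, .inr (not_distanceHereditary_compl_of_hasInducedCopy h)⟩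
end

section
/- A connected graph G is in DH ∩ co-DH if and only if G admits a sequence of twin eliminations reducing it to an induced subgraph of the Bull. -/
open SimpleGraph

/-- The Bull: triangle 0,1,2 with pendant vertices 3 (adjacent to 0) and 4 (adjacent to 1). -/
def Bull : SimpleGraph (Fin 5) := fromEdgeSet {s(0,1), s(0,2), s(1,2), s(0,3), s(1,4)}

/-- One twin-elimination step on vertex subsets: remove from `s` a vertex having a twin
in the graph induced on `s`. -/
def TwinElimStep {V : Type*} (G : SimpleGraph V) (s t : Set V) : Prop :=
  ∃ v ∈ s, t = s \ {v} ∧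
    ∃ u ∈ s, u ≠ v ∧ ∀ w ∈ s, w ≠ u → w ≠ v → (G.Adj u w ↔ G.Adj v w)

/-- `a - b - c - d` is an induced path on four vertices. -/
def IsInducedP4 {V : Type*} (G : SimpleGraph V) (a b c d : V) : Prop :=
  G.Adj a b ∧ G.Adj b c ∧ G.Adj c d ∧ ¬ G.Adj a c ∧ ¬ G.Adj a d ∧ ¬ G.Adj b d

/-- In the graph induced on `s`, no vertex sees both ends of an induced `P₄`, and every vertex sees
one of its two inner vertices. Equivalently the induced graph has no induced `C₅`, `P₅`, house, gem
or co-gem. -/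
def RestrictedP4On {V : Type*} (G : SimpleGraph V) (s : Set V) : Prop :=
  ∀ a ∈ s, ∀ b ∈ s, ∀ c ∈ s, ∀ d ∈ s, IsInducedP4 G a b c d →
    ∀ x ∈ s, ¬ (G.Adj x a ∧ G.Adj x d) ∧ (G.Adj x b ∨ G.Adj x c)

/-- The graph induced on `s` has no induced `P₄`. -/
def P4FreeOn {V : Type*} (G : SimpleGraph V) (s : Set V) : Prop :=
  ∀ a ∈ s, ∀ b ∈ s, ∀ c ∈ s, ∀ d ∈ s, ¬ IsInducedP4 G a b c d

/-- `u` and `v` are distinct twins in the graph induced on `s`. -/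
def TwinsOn {V : Type*} (G : SimpleGraph V) (s : Set V) (u v : V) : Prop :=
  u ∈ s ∧ v ∈ s ∧ u ≠ v ∧ ∀ w ∈ s, w ≠ u → w ≠ v → (G.Adj u w ↔ G.Adj v w)

/-- The graph induced on `t` or its complement is disconnected. -/
def SplitsOn {V : Type*} (G : SimpleGraph V) (t : Set V) : Prop :=
  ∃ P Q : Set V, P.Nonempty ∧ Q.Nonempty ∧ Disjoint P Q ∧ t = P ∪ Q ∧
    ((∀ p ∈ P, ∀ q ∈ Q, G.Adj p q) ∨ (∀ p ∈ P, ∀ q ∈ Q, ¬ G.Adj p q))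

section

variable {V : Type*} {G : SimpleGraph V}

lemma IsInducedP4.of_compl {a b c d : V} (h : IsInducedP4 Gᶜ a b c d) :
    IsInducedP4 G c a d b := by
  simp only [IsInducedP4, compl_adj] at *
  grind [G.adj_comm]

lemma IsInducedP4.compl {a b c d : V} (h : IsInducedP4 G a b c d) :
    IsInducedP4 Gᶜ c a d b := by
  simp only [IsInducedP4, compl_adj] at *
  grind [G.adj_comm]

lemma IsInducedP4.reverse {a b c d : V} (h : IsInducedP4 G a b c d) :
    IsInducedP4 G d c b a := by
  simp only [IsInducedP4] at *
  grind [G.adj_comm]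

lemma RestrictedP4On.compl {s : Set V} (h : RestrictedP4On G s) : RestrictedP4On Gᶜ s := by
  intro a ha b hb c hc d hd hP x hx
  have h1 := h c hc a ha d hd b hb hP.of_compl x hx
  simp only [IsInducedP4, compl_adj] at *
  grind [G.adj_comm]

lemma P4FreeOn.compl {s : Set V} (h : P4FreeOn G s) : P4FreeOn Gᶜ s :=
  fun a ha b hb c hc d hd hP => h c hc a ha d hd b hb hP.of_compl

lemma P4FreeOn.mono {s t : Set V} (h : P4FreeOn G s) (hts : t ⊆ s) : P4FreeOn G t :=
  fun a ha b hb c hc d hd => h a (hts ha) b (hts hb) c (hts hc) d (hts hd)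

/-! ### Distance-heredity in terms of induced paths -/

lemma exists_adj_dist_eq {u v : V} {n : ℕ} (h : G.dist u v = n + 1) :
    ∃ w, G.Adj u w ∧ G.dist w v = n := by
  have hr : G.Reachable u v := by
    by_contra hr
    rw [dist_eq_zero_of_not_reachable hr] at h
    omega
  obtain ⟨p, hp⟩ := hr.exists_walk_length_eq_dist
  cases p with
  | nil => simp at h
  | @cons _ w _ hadj q =>
    refine ⟨w, hadj, ?_⟩
    rw [Walk.length_cons] at hp
    have h1 := dist_le q
    obtain ⟨r, hr⟩ := q.reachable.exists_walk_length_eq_dist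
    have h2 := dist_le (Walk.cons hadj r)
    rw [Walk.length_cons] at h2
    omega

lemma DistanceHereditary.not_adj_ends (h : DistanceHereditary G) {a b c d x : V}
    (hP : IsInducedP4 G a b c d) : ¬ (G.Adj x a ∧ G.Adj x d) := by
  rintro ⟨hxa, hxd⟩
  obtain ⟨hab, hbc, hcd, hac, had, hbd⟩ := hP
  set s : Set V := {a, b, c, d} with hs
  set a' : s := ⟨a, by simp [hs]⟩
  set b' : s := ⟨b, by simp [hs]⟩
  set c' : s := ⟨c, by simp [hs]⟩
  set d' : s := ⟨d, by simp [hs]⟩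
  have hab' : (G.induce s).Adj a' b' := hab
  have hbc' : (G.induce s).Adj b' c' := hbc
  have hcd' : (G.induce s).Adj c' d' := hcd
  have hconn : (G.induce s).Connected := by
    rw [connected_iff_exists_forall_reachable]
    refine ⟨a', ?_⟩
    rintro ⟨y, rfl | rfl | rfl | rfl⟩
    · exact .refl _
    · exact hab'.reachable
    · exact hab'.reachable.trans hbc'.reachable
    · exact (hab'.reachable.trans hbc'.reachable).trans hcd'.reachable
  have h1 := h s hconn a' d'
  have h2 : G.dist a d ≤ 2 := dist_le (.cons hxa.symm (.cons hxd .nil))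
  change _ = G.dist a d at h1
  rw [← h1] at h2
  rcases Nat.le_succ_iff.1 h2 with h2 | h2
  · rcases Nat.le_succ_iff.1 h2 with h2 | h2
    · have := congrArg Subtype.val (hconn.dist_eq_zero_iff.1 (Nat.le_zero.1 h2))
      change a = d at this
      exact hac (this ▸ hcd.symm)
    · exact had (dist_eq_one_iff_adj (G := G.induce s).1 h2)
  · obtain ⟨⟨y, hy⟩, hay, hyd⟩ := exists_adj_dist_eq h2
    replace hyd : G.Adj y d := dist_eq_one_iff_adj (G := G.induce s).1 hyd
    replace hay : G.Adj a y := hay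
    rcases hy with rfl | rfl | rfl | rfl
    · exact had hyd
    · exact hbd hyd
    · exact hac hay
    · exact had hay

lemma RestrictedP4On.distanceHereditary (h : RestrictedP4On G Set.univ) :
    DistanceHereditary G := by
  intro s hconn
  have hstep : ∀ {x y v : s}, (G.induce s).Adj x y →
      (G.induce s).dist x v ≤ (G.induce s).dist y v + 1 := fun {x y v} hxy => by
    have h1 := hconn.dist_triangle (u := x) (v := y) (w := v)
    rw [dist_eq_one_iff_adj.2 hxy] at h1
    omega
  have hfar : ∀ {x y v : s}, (G.induce s).dist y v + 1 < (G.induce s).dist x v →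
      ¬ G.Adj x y := fun {x y v} hlt hxy =>
    hlt.not_ge (hstep (v := v) (show (G.induce s).Adj x y from hxy))
  have hpath : ∀ {u v : s}, (G.induce s).dist u v = 3 →
      ∃ b c : s, (G.induce s).dist b v = 2 ∧ (G.induce s).dist c v = 1 ∧
        IsInducedP4 G u b c v := fun {u v} huv => by
    obtain ⟨b, hub, hb⟩ := exists_adj_dist_eq huv
    obtain ⟨c, hbc, hc⟩ := exists_adj_dist_eq hb
    have hv : (G.induce s).dist v v = 0 := dist_self
    exact ⟨b, c, hb, hc, hub, hbc, dist_eq_one_iff_adj (G := G.induce s).1 hc, hfar (v := v) (by omega),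
      hfar (v := v) (by omega), hfar (v := v) (by omega)⟩
  have hlt : ∀ n : ℕ, ∀ u v : s, (G.induce s).dist u v = n → n ≤ 3 := fun n => by
    induction n with
    | zero => simp
    | succ n ih =>
      intro u v huv
      obtain ⟨w, huw, hw⟩ := exists_adj_dist_eq huv
      by_contra hn
      have hw3 : (G.induce s).dist w v = 3 := by
        have := ih w v hw
        omega
      obtain ⟨c, d, hc, hd, hP⟩ := hpath hw3
      rcases (h w trivial c trivial d trivial v trivial hP u trivial).2 with h1 | h1
      · exact hfar (v := v) (by omega) h1
      · exact hfar (v := v) (by omega) h1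
  intro u v
  obtain ⟨p, hp⟩ := hconn.exists_walk_length_eq_dist u v
  have hle : G.dist u v ≤ (G.induce s).dist u v := by
    rw [← hp, ← p.length_map (Embedding.induce s).toHom]
    exact dist_le _
  have hr : G.Reachable u v := (p.map (Embedding.induce s).toHom).reachable
  refine le_antisymm ?_ hle
  have h3 := hlt _ u v rfl
  by_contra! hcon
  obtain h0 | h1 | h2 : G.dist u v = 0 ∨ G.dist u v = 1 ∨ G.dist u v = 2 := by omega
  · have : u = v := Subtype.ext (hr.dist_eq_zero_iff.1 h0)
    subst this
    simp at hcon
  · have : (G.induce s).Adj u v := dist_eq_one_iff_adj (G := G).1 h1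
    rw [dist_eq_one_iff_adj.2 this] at hcon
    omega
  · obtain ⟨b, c, -, -, hP⟩ := hpath (u := u) (v := v) (by omega)
    obtain ⟨w, huw, hw⟩ := exists_adj_dist_eq h2
    exact (h u trivial b trivial c trivial v trivial hP w trivial).1
      ⟨huw.symm, dist_eq_one_iff_adj.1 hw⟩

lemma distanceHereditary_and_compl_iff :
    (DistanceHereditary G ∧ DistanceHereditary Gᶜ) ↔ RestrictedP4On G Set.univ := by
  refine ⟨?_, fun h => ⟨h.distanceHereditary, h.compl.distanceHereditary⟩⟩
  rintro ⟨h1, h2⟩ a - b - c - d - hP x -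
  refine ⟨h1.not_adj_ends hP, ?_⟩
  have h3 := h2.not_adj_ends (x := x) hP.compl
  simp only [IsInducedP4, compl_adj] at *
  grind [G.adj_comm]

/-! ### Twins in `P₄`-free graphs -/

lemma SplitsOn.of_compl {t : Set V} (h : SplitsOn Gᶜ t) : SplitsOn G t := by
  obtain ⟨P, Q, hP, hQ, hd, rfl, h⟩ := h
  refine ⟨P, Q, hP, hQ, hd, rfl, ?_⟩
  have hne : ∀ p ∈ P, ∀ q ∈ Q, p ≠ q := fun p hp q hq => hd.ne_of_mem hp hq
  simp only [compl_adj] at h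
  grind

lemma splitsOn_insert_of_not_adj {P Q : Set V} {v : V} (hP : P.Nonempty) (hQ : Q.Nonempty)
    (hd : Disjoint P Q) (hvP : v ∉ P) (hvQ : v ∉ Q) (hPQ : ∀ p ∈ P, ∀ q ∈ Q, ¬ G.Adj p q)
    (h4 : P4FreeOn G (insert v (P ∪ Q))) : SplitsOn G (insert v (P ∪ Q)) := by
  have main : ∀ P Q : Set V, Q.Nonempty → Disjoint P Q → v ∉ P → v ∉ Q →
      (∀ p ∈ P, ∀ q ∈ Q, ¬ G.Adj p q) → P4FreeOn G (insert v (P ∪ Q)) →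
      (∃ p ∈ P, ¬ G.Adj v p) → SplitsOn G (insert v (P ∪ Q)) := by
    clear * -
    rintro P Q ⟨q₀, hq₀⟩ hd hvP hvQ hPQ h4 ⟨p₀, hp₀, hvp₀⟩
    by_cases hv : ∃ q ∈ Q, G.Adj v q
    · obtain ⟨q, hq, hvq⟩ := hv
      refine ⟨{p ∈ P | ¬ G.Adj v p}, insert v ({p ∈ P | G.Adj v p} ∪ Q), ⟨p₀, hp₀, hvp₀⟩,
        ⟨v, Set.mem_insert _ _⟩, ?_, ?_, Or.inr ?_⟩
      · rw [Set.disjoint_left] at hd ⊢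
        grind
      · ext y
        grind
      · rintro p ⟨hp, hvp⟩ y (rfl | ⟨hy, hvy⟩ | hy) hadj
        · exact hvp hadj.symm
        · refine h4 p (by grind) y (by grind) v (by grind) q (by grind)
            ⟨hadj, hvy.symm, hvq, fun h => hvp h.symm, hPQ p hp q hq, hPQ y hy q hq⟩
        · exact hPQ p hp y hy hadj
    · refine ⟨Q, insert v P, ⟨q₀, hq₀⟩, ⟨v, Set.mem_insert _ _⟩, ?_, ?_, Or.inr ?_⟩
      · rw [Set.disjoint_left] at hd ⊢
        grind
      · ext y
        grind
      · grind [G.adj_comm]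
  by_cases h1 : ∃ p ∈ P, ¬ G.Adj v p
  · exact main P Q hQ hd hvP hvQ hPQ h4 h1
  by_cases h2 : ∃ q ∈ Q, ¬ G.Adj v q
  · rw [Set.union_comm] at h4 ⊢
    exact main Q P hP hd.symm hvQ hvP (by grind [G.adj_comm]) h4 h2
  · refine ⟨{v}, P ∪ Q, by simp, hP.mono Set.subset_union_left, by simp [hvP, hvQ], rfl, ?_⟩
    grind

/-- A `P₄`-free graph on at least two vertices is disconnected or has disconnected complement. -/
lemma P4FreeOn.splitsOn [Finite V] {t : Set V} (h4 : P4FreeOn G t) (ht : t.Nontrivial) :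
    SplitsOn G t := by
  induction t, t.toFinite using Set.Finite.induction_on with
  | empty => simp at ht
  | @insert v t hv _ ih =>
    by_cases hnt : t.Nontrivial
    · obtain ⟨P, Q, hP, hQ, hd, rfl, h⟩ := ih (h4.mono (Set.subset_insert _ _)) hnt
      have hvP : v ∉ P := fun h => hv (Or.inl h)
      have hvQ : v ∉ Q := fun h => hv (Or.inr h)
      rcases h with h | h
      · refine SplitsOn.of_compl (splitsOn_insert_of_not_adj hP hQ hd hvP hvQ ?_ h4.compl)
        intro p hp q hq
        simp [h p hp q hq]
      · exact splitsOn_insert_of_not_adj hP hQ hd hvP hvQ h h4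
    · rw [Set.not_nontrivial_iff] at hnt
      have hne : t.Nonempty := by
        by_contra hne
        rw [Set.not_nonempty_iff_eq_empty] at hne
        simp [hne] at ht
      obtain ⟨y, rfl⟩ := hnt.eq_empty_or_singleton.resolve_left hne.ne_empty
      refine ⟨{v}, {y}, by simp, by simp, by simpa [eq_comm] using hv, rfl, ?_⟩
      simp [em]

/-- Twins of the graph induced on a module are twins. -/
lemma TwinsOn.of_module {s t : Set V} (hts : t ⊆ s)
    (hmod : ∀ y ∈ t, ∀ z ∈ t, ∀ w ∈ s, w ∉ t → (G.Adj y w ↔ G.Adj z w)) {u v : V}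
    (h : TwinsOn G t u v) : TwinsOn G s u v := by
  obtain ⟨hu, hv, hne, h⟩ := h
  refine ⟨hts hu, hts hv, hne, fun w hw h1 h2 => ?_⟩
  by_cases hwt : w ∈ t
  · exact h w hwt h1 h2
  · exact hmod u hu v hv w hw hwt

/-- A `P₄`-free graph on at least two vertices has twins. -/
lemma P4FreeOn.exists_twinsOn [Finite V] {t : Set V} (h4 : P4FreeOn G t) (ht : t.Nontrivial) :
    ∃ u v, TwinsOn G t u v := by
  induction t using WellFoundedLT.induction with
  | ind t ih =>
    obtain ⟨P, Q, hP, hQ, hd, rfl, h⟩ := h4.splitsOn ht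
    have hne : ∀ p ∈ P, ∀ q ∈ Q, p ≠ q := fun p hp q hq => hd.ne_of_mem hp hq
    by_cases hPn : P.Nontrivial
    · have hlt : P < P ∪ Q := by
        refine Set.ssubset_iff_exists.2 ⟨Set.subset_union_left, ?_⟩
        obtain ⟨q, hq⟩ := hQ
        exact ⟨q, Or.inr hq, fun hqP => hne q hqP q hq rfl⟩
      obtain ⟨u, v, huv⟩ := ih P hlt (h4.mono Set.subset_union_left) hPn
      exact ⟨u, v, huv.of_module Set.subset_union_left (by grind)⟩
    by_cases hQn : Q.Nontrivial
    · have hlt : Q < P ∪ Q := by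
        refine Set.ssubset_iff_exists.2 ⟨Set.subset_union_right, ?_⟩
        obtain ⟨p, hp⟩ := hP
        exact ⟨p, Or.inl hp, fun hpQ => hne p hp p hpQ rfl⟩
      obtain ⟨u, v, huv⟩ := ih Q hlt (h4.mono Set.subset_union_right) hQn
      exact ⟨u, v, huv.of_module Set.subset_union_right (by grind [G.adj_comm])⟩
    · rw [Set.not_nontrivial_iff] at hPn hQn
      obtain ⟨p, hp⟩ := hP
      obtain ⟨q, hq⟩ := hQ
      refine ⟨p, q, Or.inl hp, Or.inr hq, hne p hp q hq, ?_⟩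
      rintro w (hw | hw) h1 h2
      · exact absurd (hPn hw hp) h1
      · exact absurd (hQn hw hq) h2

/-! ### Twin-free graphs of the class -/

lemma Bull.adj_iff (i j : Fin 5) : Bull.Adj i j ↔
    (i, j) ∈ [(0, 1), (1, 0), (0, 2), (2, 0), (1, 2), (2, 1), (0, 3), (3, 0), (1, 4), (4, 1)] := by
  fin_cases i <;> fin_cases j <;> simp [Bull]

instance : DecidableRel Bull.Adj := fun i j => decidable_of_iff' _ (Bull.adj_iff i j)

lemma Bull.restrictedP4On : RestrictedP4On Bull Set.univ := by
  simp only [RestrictedP4On, IsInducedP4, Set.mem_univ, forall_const]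
  decide

lemma RestrictedP4On.of_embedding {s : Set V} (f : G.induce s ↪g Bull) : RestrictedP4On G s := by
  intro a ha b hb c hc d hd hP x hx
  have key : ∀ y z : s, G.Adj y z ↔ Bull.Adj (f y) (f z) := fun y z => by
    rw [f.map_adj_iff]; rfl
  have := Bull.restrictedP4On (f ⟨a, ha⟩) trivial (f ⟨b, hb⟩) trivial (f ⟨c, hc⟩) trivial
    (f ⟨d, hd⟩) trivial
  simp only [IsInducedP4, ← key] at this hP
  have := this hP (f ⟨x, hx⟩) trivial
  simpa only [← key] using this

/-- Membership in the class is preserved when a twin is added. -/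
lemma RestrictedP4On.of_twinElimStep {s t : Set V} (hst : TwinElimStep G s t)
    (h : RestrictedP4On G t) : RestrictedP4On G s := by
  obtain ⟨v, hv, rfl, u, hu, huv, htw⟩ := hst
  intro a ha b hb c hc d hd ⟨hab, hbc, hcd, hac, had, hbd⟩ x hx
  by_contra hcon
  have hne : a ≠ b ∧ a ≠ c ∧ a ≠ d ∧ b ≠ c ∧ b ≠ d ∧ c ≠ d ∧ x ≠ a ∧ x ≠ b ∧ x ≠ c ∧ x ≠ d := by
    grind [G.irrefl, G.adj_comm]
  have hmem : ∀ y ∈ s, y ≠ v → y ∈ s \ {v} := fun y hy hyv => ⟨hy, hyv⟩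
  have hu' := hmem u hu huv
  have ta := htw a ha
  have tb := htw b hb
  have tc := htw c hc
  have td := htw d hd
  have tx := htw x hx
  by_cases hav : a = v
  · have := h u hu' b (hmem b hb (by grind)) c (hmem c hc (by grind)) d (hmem d hd (by grind))
    have := fun hP => this hP x (hmem x hx (by grind))
    simp only [IsInducedP4] at this
    grind [G.adj_comm]
  by_cases hbv : b = v
  · have := h a (hmem a ha hav) u hu' c (hmem c hc (by grind)) d (hmem d hd (by grind))
    have := fun hP => this hP x (hmem x hx (by grind))
    simp only [IsInducedP4] at this
    grind [G.adj_comm]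
  by_cases hcv : c = v
  · have := h a (hmem a ha hav) b (hmem b hb hbv) u hu' d (hmem d hd (by grind))
    have := fun hP => this hP x (hmem x hx (by grind))
    simp only [IsInducedP4] at this
    grind [G.adj_comm]
  have := h a (hmem a ha hav) b (hmem b hb hbv) c (hmem c hc hcv)
  by_cases hdv : d = v
  · have := fun hP => this u hu' hP x (hmem x hx (by grind))
    simp only [IsInducedP4] at this
    grind [G.adj_comm]
  have := this d (hmem d hd hdv) ⟨hab, hbc, hcd, hac, had, hbd⟩
  by_cases hxv : x = v
  · have := this u hu'
    grind [G.adj_comm]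
  · exact hcon (this x (hmem x hx hxv))

/-- The vertices of `s` that can replace `a` in the induced path `a - b - c - d`. -/
def endClass (G : SimpleGraph V) (s : Set V) (b c d : V) : Set V :=
  {y ∈ s | G.Adj y b ∧ ¬ G.Adj y c ∧ ¬ G.Adj y d}

/-- The vertices of `s` that can replace `b` in the induced path `a - b - c - d`. -/
def innerClass (G : SimpleGraph V) (s : Set V) (a c d : V) : Set V :=
  {y ∈ s | G.Adj y a ∧ G.Adj y c ∧ ¬ G.Adj y d}

/-- The vertices of `s` that form a bull with the induced path `a - b - c - d`. -/
def noseClass (G : SimpleGraph V) (s : Set V) (a b c d : V) : Set V :=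
  {y ∈ s | ¬ G.Adj y a ∧ G.Adj y b ∧ G.Adj y c ∧ ¬ G.Adj y d}

section Classes

variable {s : Set V} {a b c d y z : V}

lemma noseClass_reverse : noseClass G s d c b a = noseClass G s a b c d := by
  ext y
  simp only [noseClass, Set.mem_ofPred_eq]
  tauto

lemma RestrictedP4On.mem_classes (h : RestrictedP4On G s) (ha : a ∈ s) (hb : b ∈ s) (hc : c ∈ s)
    (hd : d ∈ s) (hP : IsInducedP4 G a b c d) (hy : y ∈ s) :
    y ∈ endClass G s b c d ∨ y ∈ innerClass G s a c d ∨ y ∈ innerClass G s d b a ∨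
      y ∈ endClass G s c b a ∨ y ∈ noseClass G s a b c d := by
  have := h a ha b hb c hc d hd hP y hy
  simp only [endClass, innerClass, noseClass, Set.mem_ofPred_eq]
  tauto

lemma RestrictedP4On.adj_end_inner (h : RestrictedP4On G s) (ha : a ∈ s) (hc : c ∈ s)
    (hd : d ∈ s) (hP : IsInducedP4 G a b c d) (hy : y ∈ endClass G s b c d)
    (hz : z ∈ innerClass G s a c d) : G.Adj y z := by
  have := h a ha z hz.1 c hc d hd
  simp only [endClass, innerClass, IsInducedP4, Set.mem_ofPred_eq] at *
  grind [G.adj_comm]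

lemma RestrictedP4On.not_adj_end_inner (h : RestrictedP4On G s) (hb : b ∈ s) (hc : c ∈ s)
    (hd : d ∈ s) (hP : IsInducedP4 G a b c d) (hy : y ∈ endClass G s b c d)
    (hz : z ∈ innerClass G s d b a) : ¬ G.Adj y z := by
  have := h y hy.1 b hb c hc d hd
  simp only [endClass, innerClass, IsInducedP4, Set.mem_ofPred_eq] at *
  grind [G.adj_comm]

lemma RestrictedP4On.not_adj_end_end (h : RestrictedP4On G s) (ha : a ∈ s) (hb : b ∈ s)
    (hc : c ∈ s) (hd : d ∈ s) (hP : IsInducedP4 G a b c d) (hy : y ∈ endClass G s b c d)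
    (hz : z ∈ endClass G s c b a) : ¬ G.Adj y z := by
  have h1 := h y hy.1 b hb c hc d hd
  have h2 := h a ha b hb c hc z hz.1
  have h3 := h a ha b hb y hy.1 z hz.1
  simp only [endClass, IsInducedP4, Set.mem_ofPred_eq] at *
  grind [G.adj_comm]

lemma RestrictedP4On.adj_inner_inner (h : RestrictedP4On G s) (ha : a ∈ s) (hb : b ∈ s)
    (hc : c ∈ s) (hd : d ∈ s) (hP : IsInducedP4 G a b c d) (hy : y ∈ innerClass G s a c d)
    (hz : z ∈ innerClass G s d b a) : G.Adj y z := by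
  have h1 := h a ha b hb z hz.1 d hd
  have h2 := h a ha y hy.1 c hc d hd
  have h3 := h y hy.1 b hb z hz.1 d hd
  simp only [innerClass, IsInducedP4, Set.mem_ofPred_eq] at *
  grind [G.adj_comm]

lemma RestrictedP4On.not_adj_end_nose (h : RestrictedP4On G s) (ha : a ∈ s) (hc : c ∈ s)
    (hd : d ∈ s) (hP : IsInducedP4 G a b c d) (hy : y ∈ endClass G s b c d)
    (hz : z ∈ noseClass G s a b c d) : ¬ G.Adj y z := by
  have := h y hy.1 z hz.1 c hc d hd
  simp only [endClass, noseClass, IsInducedP4, Set.mem_ofPred_eq] at *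
  grind [G.adj_comm]

lemma RestrictedP4On.adj_inner_nose (h : RestrictedP4On G s) (ha : a ∈ s) (hb : b ∈ s)
    (hc : c ∈ s) (hP : IsInducedP4 G a b c d) (hy : y ∈ innerClass G s a c d)
    (hz : z ∈ noseClass G s a b c d) : G.Adj y z := by
  have := h a ha y hy.1 c hc z hz.1
  simp only [innerClass, noseClass, IsInducedP4, Set.mem_ofPred_eq] at *
  grind [G.adj_comm]

/-- A module avoided by some vertex of the graph is trivial unless the graph has twins. -/
lemma RestrictedP4On.subsingleton_of_module [Finite V] (h : RestrictedP4On G s)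
    (htw : ¬ ∃ u v, TwinsOn G s u v) {t : Set V} (hts : t ⊆ s)
    (hmod : ∀ y ∈ t, ∀ w ∈ s, w ∉ t → ∀ z ∈ t, (G.Adj y w ↔ G.Adj z w)) {x : V} (hx : x ∈ s)
    (hxt : ∀ y ∈ t, ¬ G.Adj y x) : t.Subsingleton := by
  by_contra hnt
  rw [Set.not_subsingleton_iff] at hnt
  have h4 : P4FreeOn G t := fun a ha b hb c hc d hd hP => by
    have := (h a (hts ha) b (hts hb) c (hts hc) d (hts hd) hP x hx).2
    rw [G.adj_comm x b, G.adj_comm x c] at this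
    exact this.elim (hxt b hb) (hxt c hc)
  obtain ⟨u, v, huv⟩ := h4.exists_twinsOn hnt
  exact htw ⟨u, v, huv.of_module hts fun y hy z hz w hw hwt => hmod y hy w hw hwt z hz⟩

lemma RestrictedP4On.classes_subsingleton [Finite V] (h : RestrictedP4On G s)
    (htw : ¬ ∃ u v, TwinsOn G s u v) (ha : a ∈ s) (hb : b ∈ s) (hc : c ∈ s)
    (hd : d ∈ s) (hP : IsInducedP4 G a b c d) :
    (endClass G s b c d).Subsingleton ∧ (innerClass G s a c d).Subsingleton ∧
      (noseClass G s a b c d).Subsingleton := by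
  have hP' := hP.reverse
  refine ⟨h.subsingleton_of_module htw (fun y hy => hy.1) ?_ hd fun y hy => hy.2.2.2,
    h.subsingleton_of_module htw (fun y hy => hy.1) ?_ hd fun y hy => hy.2.2.2,
    h.subsingleton_of_module htw (fun y hy => hy.1) ?_ ha fun y hy => hy.2.1⟩
  · intro y hy w hw hwt z hz
    rcases h.mem_classes ha hb hc hd hP hw with h1 | h1 | h1 | h1 | h1
    · exact absurd h1 hwt
    · exact iff_of_true (h.adj_end_inner ha hc hd hP hy h1) (h.adj_end_inner ha hc hd hP hz h1)
    · exact iff_of_false (h.not_adj_end_inner hb hc hd hP hy h1)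
        (h.not_adj_end_inner hb hc hd hP hz h1)
    · exact iff_of_false (h.not_adj_end_end ha hb hc hd hP hy h1)
        (h.not_adj_end_end ha hb hc hd hP hz h1)
    · exact iff_of_false (h.not_adj_end_nose ha hc hd hP hy h1)
        (h.not_adj_end_nose ha hc hd hP hz h1)
  · intro y hy w hw hwt z hz
    rcases h.mem_classes ha hb hc hd hP hw with h1 | h1 | h1 | h1 | h1
    · exact iff_of_true (h.adj_end_inner ha hc hd hP h1 hy).symm
        (h.adj_end_inner ha hc hd hP h1 hz).symm
    · exact absurd h1 hwt
    · exact iff_of_true (h.adj_inner_inner ha hb hc hd hP hy h1)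
        (h.adj_inner_inner ha hb hc hd hP hz h1)
    · exact iff_of_false (mt Adj.symm (h.not_adj_end_inner hc hb ha hP' h1 hy))
        (mt Adj.symm (h.not_adj_end_inner hc hb ha hP' h1 hz))
    · exact iff_of_true (h.adj_inner_nose ha hb hc hP hy h1) (h.adj_inner_nose ha hb hc hP hz h1)
  · intro y hy w hw hwt z hz
    have hy' := hy
    have hz' := hz
    rw [← noseClass_reverse] at hy' hz'
    rcases h.mem_classes ha hb hc hd hP hw with h1 | h1 | h1 | h1 | h1
    · exact iff_of_false (mt Adj.symm (h.not_adj_end_nose ha hc hd hP h1 hy))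
        (mt Adj.symm (h.not_adj_end_nose ha hc hd hP h1 hz))
    · exact iff_of_true (h.adj_inner_nose ha hb hc hP h1 hy).symm
        (h.adj_inner_nose ha hb hc hP h1 hz).symm
    · exact iff_of_true (h.adj_inner_nose hd hc hb hP' h1 hy').symm
        (h.adj_inner_nose hd hc hb hP' h1 hz').symm
    · exact iff_of_false (mt Adj.symm (h.not_adj_end_nose hd hb ha hP' h1 hy'))
        (mt Adj.symm (h.not_adj_end_nose hd hb ha hP' h1 hz'))
    · exact absurd h1 hwt

end Classes

open Classical in
/-- A graph of the class that is not an induced subgraph of the bull has twins. -/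
lemma RestrictedP4On.exists_twinsOn [Finite V] {s : Set V} (h : RestrictedP4On G s)
    (hs : IsEmpty (G.induce s ↪g Bull)) : ∃ u v, TwinsOn G s u v := by
  by_contra htw
  suffices hf : ∃ f : s → Fin 5, f.Injective ∧ ∀ y z, Bull.Adj (f y) (f z) ↔ G.Adj y z by
    obtain ⟨f, hinj, hf⟩ := hf
    exact hs.false ⟨⟨f, hinj⟩, fun {y z} => hf y z⟩
  by_cases h4 : P4FreeOn G s
  · have hsub : s.Subsingleton := by
      by_contra hnt
      exact htw (h4.exists_twinsOn (Set.not_subsingleton_iff.1 hnt))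
    have := hsub.coe_sort
    refine ⟨fun _ => 0, Function.injective_of_subsingleton _, fun y z => ?_⟩
    simp [Subsingleton.elim y z]
  simp only [P4FreeOn, not_forall, not_not] at h4
  obtain ⟨a, ha, b, hb, c, hc, d, hd, hP⟩ := h4
  obtain ⟨hA, hB, hX⟩ := h.classes_subsingleton htw ha hb hc hd hP
  obtain ⟨hD, hC, -⟩ := h.classes_subsingleton htw hd hc hb ha hP.reverse
  have hcases : ∀ y ∈ s, y = a ∨ y = b ∨ y = c ∨ y = d ∨ y ∈ noseClass G s a b c d := by
    obtain ⟨hab, hbc, hcd, hac, had, hbd⟩ := hP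
    intro y hy
    rcases h.mem_classes ha hb hc hd ⟨hab, hbc, hcd, hac, had, hbd⟩ hy with h1 | h1 | h1 | h1 | h1
    · exact .inl (hA h1 ⟨ha, hab, hac, had⟩)
    · exact .inr (.inl (hB h1 ⟨hb, hab.symm, hbc, hbd⟩))
    · exact .inr (.inr (.inl (hC h1 ⟨hc, hcd, hbc.symm, mt Adj.symm hac⟩)))
    · exact .inr (.inr (.inr (.inl (hD h1 ⟨hd, hcd.symm, mt Adj.symm hbd, mt Adj.symm had⟩))))
    · exact .inr (.inr (.inr (.inr h1)))
  let f : V → Fin 5 := fun y =>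
    if y = a then 3 else if y = b then 0 else if y = c then 1 else if y = d then 4 else 2
  have hfa : f a = 3 := by simp [f]
  have hfb : f b = 0 := by grind [IsInducedP4, G.irrefl]
  have hfc : f c = 1 := by grind [IsInducedP4, G.irrefl]
  have hfd : f d = 4 := by grind [IsInducedP4, G.irrefl, G.adj_comm]
  have hfx : ∀ x ∈ noseClass G s a b c d, f x = 2 := by
    simp only [noseClass, Set.mem_ofPred_eq, IsInducedP4] at *
    grind [G.irrefl, G.adj_comm]
  refine ⟨fun y => f y, ?_, ?_⟩
  · rintro ⟨y, hy⟩ ⟨z, hz⟩ hyz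
    refine Subtype.ext ?_
    change f y = f z at hyz
    change y = z
    rcases hcases y hy with rfl | rfl | rfl | rfl | h1 <;>
    rcases hcases z hz with rfl | rfl | rfl | rfl | h2 <;>
    first
    | rfl
    | exact hX h1 h2
    | (exfalso; simp_all)
  · rintro ⟨y, hy⟩ ⟨z, hz⟩
    obtain ⟨hab, hbc, hcd, hac, had, hbd⟩ := hP
    change Bull.Adj (f y) (f z) ↔ G.Adj y z
    have hxa : ∀ x ∈ noseClass G s a b c d, ¬ G.Adj x a := fun x hx => hx.2.1
    have hxb : ∀ x ∈ noseClass G s a b c d, G.Adj x b := fun x hx => hx.2.2.1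
    have hxc : ∀ x ∈ noseClass G s a b c d, G.Adj x c := fun x hx => hx.2.2.2.1
    have hxd : ∀ x ∈ noseClass G s a b c d, ¬ G.Adj x d := fun x hx => hx.2.2.2.2
    have hxx : ∀ x ∈ noseClass G s a b c d, ∀ x' ∈ noseClass G s a b c d, ¬ G.Adj x x' :=
      fun x hx x' hx' hadj => hadj.ne (hX hx hx')
    clear_value f
    rcases hcases y hy with h1 | h1 | h1 | h1 | h1 <;>
    rcases hcases z hz with h2 | h2 | h2 | h2 | h2 <;>
    simp [h1, h2, hfa, hfb, hfc, hfd, hfx, Bull.adj_iff, hab, hab.symm, hbc, hbc.symm, hcd,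
      hcd.symm, hac, mt Adj.symm hac, had, mt Adj.symm had, hbd, mt Adj.symm hbd, hxa, hxb, hxc,
      hxd, hxx, G.adj_comm a z, G.adj_comm b z, G.adj_comm c z, G.adj_comm d z]

lemma RestrictedP4On.exists_reflTransGen [Finite V] {s : Set V} (h : RestrictedP4On G s) :
    ∃ t : Set V, Relation.ReflTransGen (TwinElimStep G) s t ∧ Nonempty (G.induce t ↪g Bull) := by
  induction s using WellFoundedLT.induction with
  | ind s ih =>
    by_cases hs : Nonempty (G.induce s ↪g Bull)
    · exact ⟨s, .refl, hs⟩
    · obtain ⟨u, v, hu, hv, huv, htw⟩ := h.exists_twinsOn (not_nonempty_iff.1 hs)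
      have hlt : s \ {v} < s := Set.sdiff_singleton_ssubset.2 hv
      obtain ⟨t, hst, ht⟩ := ih _ hlt fun a ha b hb c hc d hd hP x hx =>
        h a ha.1 b hb.1 c hc.1 d hd.1 hP x hx.1
      exact ⟨t, .head ⟨v, hv, rfl, u, hu, huv, htw⟩ hst, ht⟩

end

/-- a connected graph is in DH ∩ co-DH iff it reduces by twin eliminations
to an induced subgraph of the Bull. -/
theorem stmt16 {V : Type*} [Fintype V] (G : SimpleGraph V) (hconn : G.Connected) :
    (DistanceHereditary G ∧ DistanceHereditary Gᶜ) ↔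
      ∃ s : Set V, Relation.ReflTransGen (TwinElimStep G) Set.univ s ∧
        Nonempty (G.induce s ↪g Bull) := by
  rw [distanceHereditary_and_compl_iff]
  refine ⟨fun h => h.exists_reflTransGen, ?_⟩
  rintro ⟨s, hs, ⟨f⟩⟩
  generalize Set.univ = r at hs ⊢
  induction hs using Relation.ReflTransGen.head_induction_on with
  | refl => exact .of_embedding f
  | head hst _ ih => exact ih.of_twinElimStep hst
end
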